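/- There exists a constant C > 0, independent of f, a and b, such that the following holds: if f : ℝ → E is twice continuously differentiable on [a, b] and m = (a + b)/2, then ‖(f(a) + f(b))/2 − f(m)‖² ≤ C·(b − a)³·∫_a^b ‖f''(s)‖² ds. -/

import Mathlib

open MeasureTheory intervalIntegral

/-- Cauchy–Schwarz against the constant function `1` on a bounded interval. -/
theorem sq_intervalIntegral_le_mul_intervalIntegral_sq {u : ℝ → ℝ} {a b : ℝ} (hab : a < b)
    (hu : ContinuousOn u (Set.Icc a b)) :
    (∫ s in a..b, u s) ^ 2 ≤ (b - a) * ∫ s in a..b, u s ^ 2 := by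
  have hL : 0 < b - a := sub_pos.2 hab
  have hi : IntervalIntegrable u volume a b := hu.intervalIntegrable_of_Icc hab.le
  have hi2 : IntervalIntegrable (fun s => u s ^ 2) volume a b :=
    (hu.pow 2).intervalIntegrable_of_Icc hab.le
  set I := ∫ s in a..b, u s with hI
  have h0 : 0 ≤ ∫ s in a..b, ((b - a) * u s - I) ^ 2 :=
    integral_nonneg hab.le fun s _ => sq_nonneg _
  have h1 : ∫ s in a..b, ((b - a) * u s - I) ^ 2 =
      (b - a) ^ 2 * (∫ s in a..b, u s ^ 2) - (2 * (b - a) * I) * I + (b - a) * I ^ 2 := by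
    have h2 : ∀ s, ((b - a) * u s - I) ^ 2 =
        (b - a) ^ 2 * u s ^ 2 - (2 * (b - a) * I) * u s + I ^ 2 := fun s => by ring
    simp_rw [h2]
    rw [integral_add ((hi2.const_mul _).sub (hi.const_mul _)) intervalIntegrable_const,
      integral_sub (hi2.const_mul _) (hi.const_mul _),
      intervalIntegral.integral_const_mul, intervalIntegral.integral_const_mul,
      intervalIntegral.integral_const, ← hI, smul_eq_mul]
  rw [h1] at h0
  refine le_of_mul_le_mul_left ?_ hL
  linarith

/-- The oscillation of a function on `[a, b]` is at most the integral of the norm of its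
derivative. -/
theorem norm_sub_le_intervalIntegral_norm_deriv {E : Type*} [NormedAddCommGroup E]
    [NormedSpace ℝ E] [CompleteSpace E] {g h : ℝ → E} {a b x y : ℝ}
    (hg : ∀ t ∈ Set.Icc a b, HasDerivWithinAt g (h t) (Set.Icc a b) t)
    (hh : ContinuousOn h (Set.Icc a b)) (hax : a ≤ x) (hxy : x ≤ y) (hyb : y ≤ b) :
    ‖g y - g x‖ ≤ ∫ s in a..b, ‖h s‖ := by
  have hsub : Set.Icc x y ⊆ Set.Icc a b := Set.Icc_subset_Icc hax hyb
  have hftc : ∫ s in x..y, h s = g y - g x :=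
    integral_eq_sub_of_hasDerivAt_of_le hxy
      (fun t ht => ((hg t (hsub ht)).continuousWithinAt).mono hsub)
      (fun t ht => (hg t (hsub (Set.Ioo_subset_Icc_self ht))).hasDerivAt
        (Icc_mem_nhds (hax.trans_lt ht.1) (ht.2.trans_le hyb)))
      ((hh.mono hsub).intervalIntegrable_of_Icc hxy)
  rw [← hftc]
  exact (intervalIntegral.norm_integral_le_integral_norm hxy).trans <|
    integral_mono_interval hax hxy hyb (Filter.Eventually.of_forall fun s => norm_nonneg _)
      (hh.norm.intervalIntegrable_of_Icc (hax.trans (hxy.trans hyb)))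

/-- The second symmetric difference at the midpoint is controlled by the `L¹` norm of the second
derivative. -/
theorem norm_add_sub_two_smul_midpoint_le {E : Type*} [NormedAddCommGroup E]
    [NormedSpace ℝ E] [CompleteSpace E] {f g h : ℝ → E} {a b : ℝ} (hab : a ≤ b)
    (hf : ∀ t ∈ Set.Icc a b, HasDerivWithinAt f (g t) (Set.Icc a b) t)
    (hg : ∀ t ∈ Set.Icc a b, HasDerivWithinAt g (h t) (Set.Icc a b) t)
    (hh : ContinuousOn h (Set.Icc a b)) :
    ‖f a + f b - (2 : ℝ) • f ((a + b) / 2)‖ ≤ (∫ s in a..b, ‖h s‖) * ((b - a) / 2) := by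
  set m := (a + b) / 2 with hm
  set r := (b - a) / 2 with hr
  have hplus : Set.MapsTo (fun t => m + t) (Set.Icc 0 r) (Set.Icc a b) := fun t ht =>
    ⟨by linarith [ht.1], by linarith [ht.2]⟩
  have hminus : Set.MapsTo (fun t => m - t) (Set.Icc 0 r) (Set.Icc a b) := fun t ht =>
    ⟨by linarith [ht.2], by linarith [ht.1]⟩
  have hderiv : ∀ t ∈ Set.Icc 0 r, HasDerivWithinAt (fun t => f (m + t) + f (m - t))
      (g (m + t) - g (m - t)) (Set.Icc 0 r) t := by
    intro t ht
    have h1 := (hf _ (hplus ht)).scomp t (((hasDerivAt_id t).const_add m).hasDerivWithinAt) hplus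
    have h2 := (hf _ (hminus ht)).scomp t (((hasDerivAt_id t).const_sub m).hasDerivWithinAt) hminus
    have h3 := h1.add h2
    rw [one_smul, neg_one_smul, ← sub_eq_add_neg] at h3
    exact h3
  have key := norm_image_sub_le_of_norm_deriv_le_segment' hderiv
    (fun t ht => norm_sub_le_intervalIntegral_norm_deriv hg hh
      (hminus (Set.Ico_subset_Icc_self ht)).1 (by linarith [ht.1])
      (hplus (Set.Ico_subset_Icc_self ht)).2) r ⟨by linarith, le_rfl⟩
  have hb : m + r = b := by rw [hm, hr]; ring
  have ha : m - r = a := by rw [hm, hr]; ring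
  simpa only [hb, ha, add_zero, sub_zero, ← two_smul ℝ (f m), add_comm (f b)] using key

/-- Consistency estimate for the Crank–Nicolson midpoint: there is a constant `C > 0`,
independent of `f`, `a`, `b`, such that for `f : ℝ → E` twice continuously differentiable
on `[a, b]` and `m = (a + b)/2`,
`‖(f a + f b)/2 − f m‖² ≤ C (b − a)³ ∫_a^b ‖f''(s)‖² ds`. -/
theorem midpoint_consistency_estimate
    {E : Type*} [NormedAddCommGroup E] [InnerProductSpace ℝ E] [CompleteSpace E] :
    ∃ C : ℝ, 0 < C ∧ ∀ (f : ℝ → E) (a b : ℝ), a < b →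
      ContDiffOn ℝ 2 f (Set.Icc a b) →
      ‖(2 : ℝ)⁻¹ • (f a + f b) - f ((a + b) / 2)‖ ^ 2 ≤
        C * (b - a) ^ 3 *
          ∫ s in a..b, ‖iteratedDerivWithin 2 f (Set.Icc a b) s‖ ^ 2 := by
  refine ⟨1 / 16, by norm_num, fun f a b hab hf => ?_⟩
  have hu : UniqueDiffOn ℝ (Set.Icc a b) := uniqueDiffOn_Icc hab
  have hdf : ∀ t ∈ Set.Icc a b, HasDerivWithinAt f
      (iteratedDerivWithin 1 f (Set.Icc a b) t) (Set.Icc a b) t := fun t ht => by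
    rw [iteratedDerivWithin_one]
    exact (hf.differentiableOn two_ne_zero t ht).hasDerivWithinAt
  have hdg : ∀ t ∈ Set.Icc a b, HasDerivWithinAt (iteratedDerivWithin 1 f (Set.Icc a b))
      (iteratedDerivWithin 2 f (Set.Icc a b) t) (Set.Icc a b) t := fun t ht => by
    rw [iteratedDerivWithin_succ (n := 1)]
    exact (hf.differentiableOn_iteratedDerivWithin (by norm_num) hu t ht).hasDerivWithinAt
  have hh : ContinuousOn (iteratedDerivWithin 2 f (Set.Icc a b)) (Set.Icc a b) :=
    hf.continuousOn_iteratedDerivWithin le_rfl hu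
  have h1 := norm_add_sub_two_smul_midpoint_le hab.le hdf hdg hh
  have h2 := sq_intervalIntegral_le_mul_intervalIntegral_sq hab hh.norm
  have h3 : (2 : ℝ)⁻¹ • (f a + f b) - f ((a + b) / 2) =
      (2 : ℝ)⁻¹ • (f a + f b - (2 : ℝ) • f ((a + b) / 2)) := by
    rw [smul_sub, inv_smul_smul₀ two_ne_zero]
  rw [h3, norm_smul, Real.norm_of_nonneg (by norm_num), mul_pow]
  calc _ ≤ (2⁻¹ : ℝ) ^ 2 *
        ((∫ s in a..b, ‖iteratedDerivWithin 2 f (Set.Icc a b) s‖) * ((b - a) / 2)) ^ 2 := by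
        gcongr
    _ = (b - a) ^ 2 / 16 *
        (∫ s in a..b, ‖iteratedDerivWithin 2 f (Set.Icc a b) s‖) ^ 2 := by ring
    _ ≤ (b - a) ^ 2 / 16 *
        ((b - a) * ∫ s in a..b, ‖iteratedDerivWithin 2 f (Set.Icc a b) s‖ ^ 2) := by gcongr
    _ = _ := by ring
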